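/- Suppose each message m of a distributed computation carries an integer timestamp m.t and each checkpoint C an integer timestamp C.t such that: (i) if m is sent by P_i in interval I_i^x then m.t ≥ C_i^x.t; (ii) if m is received by P_k in interval I_k^w and m' is sent by P_k in an interval I_k^{w'} with w' ≥ w, then m'.t ≥ m.t; (iii) if m is received by P_j strictly before checkpoint C_j^y then C_j^y.t > m.t; and (iv) for every process P_i, the sequence of checkpoint timestamps is nondecreasing: C_i^{x+1}.t ≥ C_i^x.t whenever C_i^{x+1} exists. Then no checkpoint lies on a Z-cycle: there is no checkpoint C with C ⇝ C. -/

import Mathlib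

/-- A distributed computation: `n ≥ 1` processes, each executing a sequence of
events indexed by positive integers; a type of messages with send/receive
processes and event indices; and for each process a (finite or infinite,
encoded by the domain predicate `hasCkpt`) strictly increasing sequence of
checkpoint event indices, starting at the index of the process's first event.
Checkpoint events are neither send nor receive events. -/
structure DistComputation where
  /-- number of processes -/
  n : ℕ
  n_pos : 1 ≤ n
  /-- the messages of the computation -/
  Msg : Type
  /-- sending process of a message -/
  snd : Msg → Fin n
  /-- index of the send event of a message -/
  sendIdx : Msg → ℕ
  /-- receiving process of a message -/
  rcv : Msg → Fin n
  /-- index of the receive event of a message -/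
  recvIdx : Msg → ℕ
  /-- event indices are positive -/
  sendIdx_pos : ∀ m, 1 ≤ sendIdx m
  recvIdx_pos : ∀ m, 1 ≤ recvIdx m
  /-- `hasCkpt i x`: process `i` has an `x`-th checkpoint (`x` counted from 1) -/
  hasCkpt : Fin n → ℕ → Prop
  /-- `ckptIdx i x`: the event index of the `x`-th checkpoint `C_i^x` of process `i` -/
  ckptIdx : Fin n → ℕ → ℕ
  /-- every process has a first checkpoint -/
  hasCkpt_one : ∀ i, hasCkpt i 1
  /-- the checkpoints of a process form an initial segment -/
  hasCkpt_of_succ : ∀ i x, hasCkpt i (x + 1) → hasCkpt i x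
  /-- the sequence of checkpoint indices is strictly increasing -/
  ckptIdx_strictMono : ∀ i x y, hasCkpt i x → hasCkpt i y → x < y → ckptIdx i x < ckptIdx i y
  /-- the first checkpoint is the first event of the process -/
  ckptIdx_one : ∀ i, ckptIdx i 1 = 1
  /-- checkpoint events are not send events -/
  ckpt_ne_send : ∀ i x m, hasCkpt i x → snd m = i → sendIdx m ≠ ckptIdx i x
  /-- checkpoint events are not receive events -/
  ckpt_ne_recv : ∀ i x m, hasCkpt i x → rcv m = i → recvIdx m ≠ ckptIdx i x

/-- An event: a process together with an event index. -/
abbrev DistComputation.Event (D : DistComputation) := Fin D.n × ℕ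

/-- Causal precedence `e → e'`: the smallest transitive relation such that each
event precedes the next event of the same process and the send event of every
message precedes its receive event. -/
inductive DistComputation.Precedes (D : DistComputation) : D.Event → D.Event → Prop
  | step (i : Fin D.n) (x : ℕ) : DistComputation.Precedes D (i, x) (i, x + 1)
  | msg (m : D.Msg) :
      DistComputation.Precedes D (D.snd m, D.sendIdx m) (D.rcv m, D.recvIdx m)
  | trans {e e' e'' : D.Event} : DistComputation.Precedes D e e' →
      DistComputation.Precedes D e' e'' → DistComputation.Precedes D e e''

/-- The event of process `k` with index `e` lies in the checkpoint interval
`I_k^w`: at or after `C_k^w` and, if `C_k^{w+1}` exists, strictly before it. -/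
def DistComputation.InInterval (D : DistComputation) (k : Fin D.n) (w : ℕ) (e : ℕ) : Prop :=
  D.hasCkpt k w ∧ D.ckptIdx k w ≤ e ∧ (D.hasCkpt k (w + 1) → e < D.ckptIdx k (w + 1))

/-- `ms = [m_1, …, m_q]` is a zigzag path from checkpoint `C_i^x` to
checkpoint `C_j^y`. -/
def DistComputation.IsZigzagPath (D : DistComputation) (ms : List D.Msg)
    (i : Fin D.n) (x : ℕ) (j : Fin D.n) (y : ℕ) : Prop :=
  ms ≠ [] ∧ D.hasCkpt i x ∧ D.hasCkpt j y ∧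
  -- `m_1` is sent by `P_i` at or after `C_i^x`
  (∀ m₁ ∈ ms.head?, D.snd m₁ = i ∧ D.ckptIdx i x ≤ D.sendIdx m₁) ∧
  -- each `m_z` is received by the process sending `m_{z+1}`, and if `m_z` is
  -- received in interval `I_k^w` then `m_{z+1}` is sent in an interval
  -- `I_k^{w'}` with `w' ≥ w`
  (∀ z : ℕ, ∀ hz : z + 1 < ms.length,
    D.rcv (ms[z]'(Nat.lt_of_succ_lt hz)) = D.snd (ms[z + 1]'hz) ∧
    ∀ w : ℕ, D.InInterval (D.rcv (ms[z]'(Nat.lt_of_succ_lt hz))) w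
        (D.recvIdx (ms[z]'(Nat.lt_of_succ_lt hz))) →
      ∃ w' : ℕ, w ≤ w' ∧
        D.InInterval (D.rcv (ms[z]'(Nat.lt_of_succ_lt hz))) w'
          (D.sendIdx (ms[z + 1]'hz))) ∧
  -- `m_q` is received by `P_j` strictly before `C_j^y`
  (∀ mq ∈ ms.getLast?, D.rcv mq = j ∧ D.recvIdx mq < D.ckptIdx j y)

/-- `C_i^x ⇝ C_j^y`: there is a zigzag path from `C_i^x` to `C_j^y`. -/
def DistComputation.ZigzagTo (D : DistComputation)
    (i : Fin D.n) (x : ℕ) (j : Fin D.n) (y : ℕ) : Prop :=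
  ∃ ms : List D.Msg, D.IsZigzagPath ms i x j y

/-- A zigzag path is causal if the send event of each `m_{z+1}` has index at
least the index of the receive event of `m_z` in their common process. -/
def DistComputation.IsCausal (D : DistComputation) (ms : List D.Msg) : Prop :=
  ∀ z : ℕ, ∀ hz : z + 1 < ms.length,
    D.recvIdx (ms[z]'(Nat.lt_of_succ_lt hz)) ≤ D.sendIdx (ms[z + 1]'hz)

/-- A logical-clock assignment on a distributed computation: an integer clock
`lc` on events, nondecreasing along each process, strictly increasing at each
checkpoint event having a predecessor; message timestamps equal to the clock
of the send event; and the clock at a receive event at least the message's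
timestamp. -/
structure LogicalClock (D : DistComputation) where
  /-- the logical clock of each event -/
  lc : D.Event → ℤ
  /-- the timestamp `m.t` of each message -/
  mt : D.Msg → ℤ
  /-- the clock is nondecreasing along each process's event sequence -/
  lc_mono : ∀ (i : Fin D.n) (x y : ℕ), x ≤ y → lc (i, x) ≤ lc (i, y)
  /-- the clock strictly increases at a checkpoint event that has an
  immediately preceding event of the same process -/
  lc_ckpt : ∀ (i : Fin D.n) (x : ℕ), D.hasCkpt i x → 2 ≤ D.ckptIdx i x →
      lc (i, D.ckptIdx i x - 1) < lc (i, D.ckptIdx i x)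
  /-- `m.t` is the clock of the send event of `m` -/
  mt_send : ∀ m, mt m = lc (D.snd m, D.sendIdx m)
  /-- the clock at the receive event of `m` is at least `m.t` -/
  mt_recv : ∀ m, mt m ≤ lc (D.rcv m, D.recvIdx m)

/-- The timestamp `C_i^x.t` of checkpoint `C_i^x` under a logical-clock
assignment: the clock of the checkpoint event. -/
def LogicalClock.ckptT {D : DistComputation} (L : LogicalClock D)
    (i : Fin D.n) (x : ℕ) : ℤ :=
  L.lc (i, D.ckptIdx i x)

/-- Every event at or after a checkpoint lies in the interval of that checkpoint or of a later one
of the same process. -/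
theorem DistComputation.exists_inInterval (D : DistComputation) {i : Fin D.n} {x e : ℕ}
    (hx : D.hasCkpt i x) (he : D.ckptIdx i x ≤ e) : ∃ w, x ≤ w ∧ D.InInterval i w e := by
  by_cases hs : D.hasCkpt i (x + 1) ∧ D.ckptIdx i (x + 1) ≤ e
  · have hlt := D.ckptIdx_strictMono i x (x + 1) hx hs.1 (Nat.lt_succ_self x)
    obtain ⟨w, hw, hI⟩ := D.exists_inInterval hs.1 hs.2
    exact ⟨w, by omega, hI⟩
  · exact ⟨x, le_rfl, hx, he, fun h => not_le.mp fun h' => hs ⟨h, h'⟩⟩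
termination_by e - D.ckptIdx i x
decreasing_by omega

/-- Every receive event lies in some checkpoint interval of the receiving process. -/
theorem DistComputation.exists_inInterval_recv (D : DistComputation) (m : D.Msg) :
    ∃ w, D.InInterval (D.rcv m) w (D.recvIdx m) := by
  obtain ⟨w, -, hw⟩ := D.exists_inInterval (D.hasCkpt_one (D.rcv m))
    ((D.ckptIdx_one _).trans_le (D.recvIdx_pos m))
  exact ⟨w, hw⟩

/-- Timestamps that are nondecreasing from each checkpoint to the next are monotone. -/
theorem DistComputation.ckpt_monotone (D : DistComputation) {ct : Fin D.n → ℕ → ℤ}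
    (h : ∀ i x, D.hasCkpt i (x + 1) → ct i x ≤ ct i (x + 1)) {i : Fin D.n} {x y : ℕ}
    (hxy : x ≤ y) (hy : D.hasCkpt i y) : ct i x ≤ ct i y := by
  induction y, hxy using Nat.le_induction with
  | base => exact le_rfl
  | succ y _ ih => exact (ih (D.hasCkpt_of_succ i y hy)).trans (h i y hy)

/-- If message and checkpoint timestamps satisfy (i)–(iv),
then no checkpoint lies on a Z-cycle. -/
theorem timestamps_no_zcycle (D : DistComputation)
    (mt : D.Msg → ℤ) (ct : Fin D.n → ℕ → ℤ)
    -- (i) if `m` is sent by `P_i` in interval `I_i^x` then `m.t ≥ C_i^x.t`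
    (h1 : ∀ (m : D.Msg) (x : ℕ),
      D.InInterval (D.snd m) x (D.sendIdx m) → ct (D.snd m) x ≤ mt m)
    -- (ii) if `m` is received by `P_k` in interval `I_k^w` and `m'` is sent by
    -- `P_k` in an interval `I_k^{w'}` with `w' ≥ w`, then `m'.t ≥ m.t`
    (h2 : ∀ (m m' : D.Msg) (w w' : ℕ), D.rcv m = D.snd m' →
      D.InInterval (D.rcv m) w (D.recvIdx m) →
      D.InInterval (D.rcv m) w' (D.sendIdx m') → w ≤ w' → mt m ≤ mt m')
    -- (iii) if `m` is received by `P_j` strictly before `C_j^y` then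
    -- `C_j^y.t > m.t`
    (h3 : ∀ (m : D.Msg) (y : ℕ), D.hasCkpt (D.rcv m) y →
      D.recvIdx m < D.ckptIdx (D.rcv m) y → mt m < ct (D.rcv m) y)
    -- (iv) checkpoint timestamps are nondecreasing along each process
    (h4 : ∀ (i : Fin D.n) (x : ℕ), D.hasCkpt i (x + 1) → ct i x ≤ ct i (x + 1)) :
    ¬ ∃ (i : Fin D.n) (x : ℕ), D.hasCkpt i x ∧ D.ZigzagTo i x i x := by
  rintro ⟨i, x, hx, ms, hne, -, -, hhead, hstep, hlast⟩
  have hpos := List.length_pos_iff.mpr hne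
  have hle : ∀ z (hz : z < ms.length), ct i x ≤ mt ms[z] := by
    intro z
    induction z with
    | zero =>
      intro hz
      obtain ⟨rfl, hsend⟩ := hhead ms[0] (by simp [List.head?_eq_getElem?])
      obtain ⟨w, hxw, hw⟩ := D.exists_inInterval hx hsend
      exact (D.ckpt_monotone h4 hxw hw.1).trans (h1 _ w hw)
    | succ z ih =>
      intro hz
      obtain ⟨hrs, hint⟩ := hstep z hz
      obtain ⟨w, hw⟩ := D.exists_inInterval_recv ms[z]
      obtain ⟨w', hww', hw'⟩ := hint w hw
      exact (ih _).trans (h2 _ _ w w' hrs hw hw' hww')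
  obtain ⟨rfl, hrecv⟩ := hlast (ms[ms.length - 1]) (by simp [List.getLast?_eq_getElem?])
  exact absurd (h3 _ x hx hrecv) (not_lt.mpr (hle _ _))
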